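/- For every nonnegative integer M and every nonzero complex number q that is not a root of unity, (1 + q^{3M}) Σ_{m,n≥0} q^{Q(m,n)-2m-3n} (q³;q³)_M / ( (q;q)_m (q³;q³)_n (q³;q³)_{M-2n-m} ) = Σ_{j=-M}^{M} q^{3j²-2j} (1 + q^{3j}) [2M choose M+j]_{q³}. -/

import Mathlib

/-- The finite q-Pochhammer symbol `(a;q)_n`. -/
noncomputable def qPoch (a q : ℂ) (n : ℕ) : ℂ :=
  ∏ j ∈ Finset.range n, (1 - a * q ^ j)

/-- The infinite q-Pochhammer symbol `(a;q)_∞`. -/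
noncomputable def qPochInf (a q : ℂ) : ℂ :=
  ∏' j : ℕ, (1 - a * q ^ j)

/-- `1/(q;q)_n` for an integer `n`, with the convention that it is `0` for `n < 0`. -/
noncomputable def qPochInvZ (q : ℂ) (n : ℤ) : ℂ :=
  if 0 ≤ n then (qPoch q q n.toNat)⁻¹ else 0

/-- The q-trinomial coefficient `(L, b; a; q)_2`. -/
noncomputable def qTrinomial (L : ℕ) (b a : ℤ) (q : ℂ) : ℂ :=
  ∑' n : ℕ, q ^ ((n : ℤ) * ((n : ℤ) + b)) * qPoch q q L * qPochInvZ q (n : ℤ) *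
    qPochInvZ q ((n : ℤ) + a) * qPochInvZ q ((L : ℤ) - 2 * (n : ℤ) - a)

/-- The q-trinomial coefficient `T_n(L, a; q)`, where `s` is a fixed square root of `q`. -/
noncomputable def qTriT (n : ℤ) (L : ℕ) (a : ℤ) (q s : ℂ) : ℂ :=
  s ^ ((L : ℤ) * ((L : ℤ) - n) - a * (a - n)) * qTrinomial L (a - n) a q⁻¹

/-- The Gaussian (q-binomial) coefficient `[N choose k]_q`, zero unless `0 ≤ k ≤ N`. -/
noncomputable def qBinom (N k : ℤ) (q : ℂ) : ℂ :=
  if 0 ≤ k ∧ k ≤ N then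
    qPoch q q N.toNat * (qPoch q q k.toNat)⁻¹ * (qPoch q q (N - k).toNat)⁻¹
  else 0

/-- The quadratic form `Q(m,n) = 2m² + 6mn + 6n²` from Capparelli's theorems. -/
def Qcap (m n : ℕ) : ℕ := 2 * m ^ 2 + 6 * m * n + 6 * n ^ 2


open Finset

section CapparelliProof

lemma capZ_succ (x : ℂ) (hx : ∀ k : ℕ, 0 < k → x ^ k ≠ 1) (m : ℕ) :
    (1 - x ^ (m + 1)) * (qPoch x x (m + 1))⁻¹ = (qPoch x x m)⁻¹ := by
  have h : qPoch x x (m + 1) = qPoch x x m * (1 - x ^ (m + 1)) := by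
    unfold qPoch
    rw [Finset.prod_range_succ, pow_succ']
  have h1 : (1 - x ^ (m + 1)) ≠ 0 := sub_ne_zero.mpr (Ne.symm (hx _ (Nat.succ_pos m)))
  rw [h, mul_inv]
  field_simp

lemma capZ_neg (x : ℂ) (n : ℤ) (h : n < 0) : qPochInvZ x n = 0 := by
  unfold qPochInvZ
  rw [if_neg (by omega)]

lemma capZ_step (x : ℂ) (hx : ∀ k : ℕ, 0 < k → x ^ k ≠ 1) (n : ℤ) :
    qPochInvZ x n - x ^ n * qPochInvZ x n = qPochInvZ x (n - 1) := by
  rcases lt_trichotomy n 0 with h | h | h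
  · rw [capZ_neg x n h, capZ_neg x (n - 1) (by omega)]; simp
  · subst h; rw [capZ_neg x (0 - 1) (by omega)]; simp
  · obtain ⟨m, rfl⟩ : ∃ m : ℕ, n = (m : ℤ) + 1 := ⟨(n - 1).toNat, by omega⟩
    have := capZ_succ x hx m
    unfold qPochInvZ
    rw [if_pos (by omega), if_pos (by omega)]
    have e1 : ((m : ℤ) + 1).toNat = m + 1 := by omega
    have e2 : ((m : ℤ) + 1 - 1).toNat = m := by omega
    have e3 : x ^ ((m : ℤ) + 1) = x ^ (m + 1) := by exact_mod_cast zpow_natCast x (m + 1)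
    rw [e1, e2, e3, ← this]; ring

lemma cube_root (q : ℂ) (hroot : ∀ k : ℕ, 0 < k → q ^ k ≠ 1) :
    ∀ k : ℕ, 0 < k → (q ^ 3) ^ k ≠ 1 := by
  intro k hk
  rw [← pow_mul]
  exact hroot _ (by omega)

/-- truncated double sum, parameters `a`, `b` -/
noncomputable def capT (q : ℂ) (K : ℕ) (M a b : ℤ) : ℂ :=
  ∑ m ∈ range K, ∑ n ∈ range K,
    q ^ (2 * (m : ℤ) ^ 2 + 6 * (m : ℤ) * (n : ℤ) + 6 * (n : ℤ) ^ 2 + a * m + b * n) *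
      (qPoch q q m)⁻¹ * (qPoch (q ^ 3) (q ^ 3) n)⁻¹ * qPochInvZ (q ^ 3) (M - 2 * n - m)

lemma capT_A (q : ℂ) (hq : q ≠ 0) (hroot : ∀ k : ℕ, 0 < k → q ^ k ≠ 1) (K : ℕ) (M a b : ℤ)
    (hM : M < K) (N a_one a_two b_two : ℤ) (s t : ℕ) (hN : N = M - 1) (ha_one : a_one = a + 1)
    (ha_two : a_two = a + 4) (hb_two : b_two = b + 6) (hs : (t : ℤ) = s + 2 + a) :
    q ^ s * (capT q K M a b - capT q K M a_one b) = q ^ t * capT q K N a_two b_two := by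
  subst hN ha_one ha_two hb_two
  rcases K with _ | k
  · simp [capT]
  unfold capT
  rw [← Finset.sum_sub_distrib, Finset.sum_range_succ']
  conv_rhs => rw [Finset.sum_range_succ]
  have z1 : ∑ n ∈ range (k + 1),
    q ^ (2 * (k : ℤ) ^ 2 + 6 * (k : ℤ) * (n : ℤ) + 6 * (n : ℤ) ^ 2 + (a + 4) * k + (b + 6) * n) *
      (qPoch q q k)⁻¹ * (qPoch (q ^ 3) (q ^ 3) n)⁻¹ *
        qPochInvZ (q ^ 3) (M - 1 - 2 * n - k) = 0 := by
    apply Finset.sum_eq_zero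
    intro n _
    rw [capZ_neg _ _ (by push_cast at hM; omega), mul_zero]
  rw [z1]
  simp only [Nat.cast_zero, mul_zero, add_zero, sub_self]
  rw [Finset.mul_sum, Finset.mul_sum]
  apply Finset.sum_congr rfl
  intro m _
  rw [← Finset.sum_sub_distrib, Finset.mul_sum, Finset.mul_sum]
  apply Finset.sum_congr rfl
  intro n _
  rw [← capZ_succ q hroot m]
  have e0 : M - 2 * (n : ℤ) - ((m + 1 : ℕ) : ℤ) = M - 1 - 2 * n - m := by push_cast; ring
  rw [e0]
  set E : ℤ := 2 * ((m + 1 : ℕ) : ℤ) ^ 2 + 6 * ((m + 1 : ℕ) : ℤ) * (n : ℤ) + 6 * (n : ℤ) ^ 2 +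
    a * ((m + 1 : ℕ) : ℤ) + b * n with hE
  have e1 : q ^ (2 * ((m + 1 : ℕ) : ℤ) ^ 2 + 6 * ((m + 1 : ℕ) : ℤ) * (n : ℤ) + 6 * (n : ℤ) ^ 2 +
    (a + 1) * ((m + 1 : ℕ) : ℤ) + b * n) = q ^ E * q ^ (m + 1) := by
    rw [← zpow_natCast q (m + 1), ← zpow_add₀ hq]; congr 1; rw [hE]; ring
  have e2 : q ^ t * q ^ (2 * (m : ℤ) ^ 2 + 6 * (m : ℤ) * (n : ℤ) + 6 * (n : ℤ) ^ 2 +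
    (a + 4) * m + (b + 6) * n) = q ^ s * q ^ E := by
    rw [← zpow_natCast q t, ← zpow_natCast q s, ← zpow_add₀ hq, ← zpow_add₀ hq]
    congr 1; rw [hE, hs]; push_cast; ring
  rw [e1]
  linear_combination -(1 - q ^ (m + 1)) * (qPoch q q (m + 1))⁻¹ *
    (qPoch (q ^ 3) (q ^ 3) n)⁻¹ * qPochInvZ (q ^ 3) (M - 1 - 2 * n - m) * e2

lemma capT_B (q : ℂ) (hq : q ≠ 0) (hroot : ∀ k : ℕ, 0 < k → q ^ k ≠ 1) (K : ℕ) (M a b : ℤ)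
    (hM : M < K) (N b_one a_two b_two : ℤ) (s t : ℕ) (hN : N = M - 2) (hb_one : b_one = b + 3)
    (ha_two : a_two = a + 6) (hb_two : b_two = b + 12) (hs : (t : ℤ) = s + 6 + b) :
    q ^ s * (capT q K M a b - capT q K M a b_one) = q ^ t * capT q K N a_two b_two := by
  subst hN hb_one ha_two hb_two
  rcases K with _ | k
  · simp [capT]
  unfold capT
  rw [← Finset.sum_sub_distrib, Finset.mul_sum, Finset.mul_sum]
  apply Finset.sum_congr rfl
  intro m _
  rw [← Finset.sum_sub_distrib, Finset.sum_range_succ', Finset.sum_range_succ _ k]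
  rw [capZ_neg _ (M - 2 - 2 * (k : ℤ) - m) (by push_cast at hM; omega)]
  simp only [Nat.cast_zero, mul_zero, add_zero, sub_self]
  rw [Finset.mul_sum, Finset.mul_sum]
  apply Finset.sum_congr rfl
  intro n _
  rw [← capZ_succ (q ^ 3) (cube_root q hroot) n]
  have e0 : M - 2 * ((n + 1 : ℕ) : ℤ) - m = M - 2 - 2 * n - m := by push_cast; ring
  rw [e0]
  set E : ℤ := 2 * (m : ℤ) ^ 2 + 6 * (m : ℤ) * ((n + 1 : ℕ) : ℤ) + 6 * ((n + 1 : ℕ) : ℤ) ^ 2 +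
    a * m + b * ((n + 1 : ℕ) : ℤ) with hE
  have e1 : q ^ (2 * (m : ℤ) ^ 2 + 6 * (m : ℤ) * ((n + 1 : ℕ) : ℤ) + 6 * ((n + 1 : ℕ) : ℤ) ^ 2 +
    a * m + (b + 3) * ((n + 1 : ℕ) : ℤ)) = q ^ E * (q ^ 3) ^ (n + 1) := by
    rw [← pow_mul, ← zpow_natCast q (3 * (n + 1)), ← zpow_add₀ hq]
    congr 1; rw [hE]; push_cast; ring
  have e2 : q ^ t * q ^ (2 * (m : ℤ) ^ 2 + 6 * (m : ℤ) * (n : ℤ) + 6 * (n : ℤ) ^ 2 +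
    (a + 6) * m + (b + 12) * n) = q ^ s * q ^ E := by
    rw [← zpow_natCast q t, ← zpow_natCast q s, ← zpow_add₀ hq, ← zpow_add₀ hq]
    congr 1; rw [hE, hs]; push_cast; ring
  rw [e1]
  linear_combination -(1 - (q ^ 3) ^ (n + 1)) * (qPoch q q m)⁻¹ *
    (qPoch (q ^ 3) (q ^ 3) (n + 1))⁻¹ * qPochInvZ (q ^ 3) (M - 2 - 2 * n - m) * e2

lemma capT_C (q : ℂ) (hq : q ≠ 0) (hroot : ∀ k : ℕ, 0 < k → q ^ k ≠ 1) (K : ℕ) (M a b : ℤ)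
    (N a_one b_one : ℤ) (w : ℂ) (hw : w = q ^ (3 * M)) (hN : N = M - 1) (ha_one : a_one = a - 3)
    (hb_one : b_one = b - 6) :
    capT q K M a b - w * capT q K M a_one b_one = capT q K N a b := by
  subst hN ha_one hb_one hw
  unfold capT
  rw [Finset.mul_sum, ← Finset.sum_sub_distrib]
  apply Finset.sum_congr rfl
  intro m _
  rw [Finset.mul_sum, ← Finset.sum_sub_distrib]
  apply Finset.sum_congr rfl
  intro n _
  have e0 : M - 1 - 2 * (n : ℤ) - m = (M - 2 * (n : ℤ) - m) - 1 := by ring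
  rw [e0, ← capZ_step (q ^ 3) (cube_root q hroot)]
  have e1 : q ^ (3 * M) * q ^ (2 * (m : ℤ) ^ 2 + 6 * (m : ℤ) * (n : ℤ) + 6 * (n : ℤ) ^ 2 +
      (a - 3) * m + (b - 6) * n) = q ^ (2 * (m : ℤ) ^ 2 + 6 * (m : ℤ) * (n : ℤ) +
      6 * (n : ℤ) ^ 2 + a * m + b * n) * (q ^ 3) ^ (M - 2 * (n : ℤ) - m) := by
    rw [← zpow_natCast q 3, ← zpow_mul, ← zpow_add₀ hq, ← zpow_add₀ hq]
    congr 1; push_cast; ring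
  linear_combination -(qPoch q q m)⁻¹ * (qPoch (q ^ 3) (q ^ 3) n)⁻¹ *
    qPochInvZ (q ^ 3) (M - 2 * n - m) * e1

/-- truncated single sum -/
noncomputable def capU (q : ℂ) (K : ℕ) (A B e : ℤ) : ℂ :=
  ∑ j ∈ Icc (-(K : ℤ)) (K : ℤ),
    q ^ (3 * j ^ 2 + e * j) * qPochInvZ (q ^ 3) (A - j) * qPochInvZ (q ^ 3) (B + j)

lemma capU_1 (q : ℂ) (hq : q ≠ 0) (hroot : ∀ k : ℕ, 0 < k → q ^ k ≠ 1) (K : ℕ) (A B e : ℤ)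
    (A_one e_one : ℤ) (w : ℂ) (hw : w = q ^ (3 * A)) (hA : A_one = A - 1) (he : e_one = e - 3) :
    capU q K A B e - w * capU q K A B e_one = capU q K A_one B e := by
  subst hA he hw
  unfold capU
  rw [Finset.mul_sum, ← Finset.sum_sub_distrib]
  apply Finset.sum_congr rfl
  intro j _
  have e0 : A - 1 - j = (A - j) - 1 := by ring
  rw [e0, ← capZ_step (q ^ 3) (cube_root q hroot)]
  have e1 : q ^ (3 * A) * q ^ (3 * j ^ 2 + (e - 3) * j) =
      q ^ (3 * j ^ 2 + e * j) * (q ^ 3) ^ (A - j) := by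
    rw [← zpow_natCast q 3, ← zpow_mul, ← zpow_add₀ hq, ← zpow_add₀ hq]
    congr 1; push_cast; ring
  linear_combination -qPochInvZ (q ^ 3) (A - j) * qPochInvZ (q ^ 3) (B + j) * e1

lemma capU_2 (q : ℂ) (hq : q ≠ 0) (hroot : ∀ k : ℕ, 0 < k → q ^ k ≠ 1) (K : ℕ) (A B e : ℤ)
    (B_one e_one : ℤ) (w : ℂ) (hw : w = q ^ (3 * B)) (hB : B_one = B - 1) (he : e_one = e + 3) :
    capU q K A B e - w * capU q K A B e_one = capU q K A B_one e := by
  subst hB he hw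
  unfold capU
  rw [Finset.mul_sum, ← Finset.sum_sub_distrib]
  apply Finset.sum_congr rfl
  intro j _
  have e0 : B - 1 + j = (B + j) - 1 := by ring
  rw [e0, ← capZ_step (q ^ 3) (cube_root q hroot)]
  have e1 : q ^ (3 * B) * q ^ (3 * j ^ 2 + (e + 3) * j) =
      q ^ (3 * j ^ 2 + e * j) * (q ^ 3) ^ (B + j) := by
    rw [← zpow_natCast q 3, ← zpow_mul, ← zpow_add₀ hq, ← zpow_add₀ hq]
    congr 1; push_cast; ring
  linear_combination -qPochInvZ (q ^ 3) (A - j) * qPochInvZ (q ^ 3) (B + j) * e1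

lemma shift_Icc (f : ℤ → ℂ) (K : ℤ) (h1 : f (-K) = 0) (h2 : f (K + 1) = 0) :
    ∑ j ∈ Icc (-K) K, f j = ∑ j ∈ Icc (-K) K, f (j + 1) := by
  have e : ∑ j ∈ Icc (-K) K, f (j + 1) = ∑ j ∈ Icc (-K + 1) (K + 1), f j := by
    rw [← Finset.map_add_right_Icc, Finset.sum_map]
    rfl
  rw [e]
  have a1 : ∑ j ∈ Icc (-K) K, f j = ∑ j ∈ Icc (-K) (K + 1), f j := by
    apply Finset.sum_subset
    · intro x; simp only [mem_Icc]; omega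
    · intro x hx hx_one
      simp only [mem_Icc] at hx hx_one
      have : x = K + 1 := by omega
      rw [this, h2]
  have a2 : ∑ j ∈ Icc (-K + 1) (K + 1), f j = ∑ j ∈ Icc (-K) (K + 1), f j := by
    apply Finset.sum_subset
    · intro x; simp only [mem_Icc]; omega
    · intro x hx hx_one
      simp only [mem_Icc] at hx hx_one
      have : x = -K := by omega
      rw [this, h1]
  rw [a1, a2]

lemma capU_3 (q : ℂ) (hq : q ≠ 0) (K : ℕ) (A B e : ℤ)
    (A_one B_one e_one : ℤ) (hA : A ≤ K) (hB : B < K) (s t : ℕ) (hA_one : A_one = A - 1) (hB_one : B_one = B + 1)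
    (he : e_one = e + 6) (hs : (t : ℤ) = s + 3 + e) :
    q ^ s * capU q K A B e = q ^ t * capU q K A_one B_one e_one := by
  subst hA_one hB_one he
  unfold capU
  rw [shift_Icc _ (K : ℤ) (by rw [capZ_neg _ (B + -(K : ℤ)) (by omega), mul_zero])
    (by rw [capZ_neg _ (A - ((K : ℤ) + 1)) (by omega), mul_zero, zero_mul]),
    Finset.mul_sum, Finset.mul_sum]
  apply Finset.sum_congr rfl
  intro j _
  have e0 : A - 1 - j = A - (j + 1) := by ring
  have e0_one : B + 1 + j = B + (j + 1) := by ring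
  rw [e0, e0_one]
  have e2 : q ^ t * q ^ (3 * j ^ 2 + (e + 6) * j) =
      q ^ s * q ^ (3 * (j + 1) ^ 2 + e * (j + 1)) := by
    rw [← zpow_natCast q t, ← zpow_natCast q s, ← zpow_add₀ hq, ← zpow_add₀ hq]
    congr 1; rw [hs]; ring
  linear_combination -qPochInvZ (q ^ 3) (A - (j + 1)) * qPochInvZ (q ^ 3) (B + (j + 1)) * e2

set_option maxHeartbeats 4000000 in
lemma capT_rec (q : ℂ) (hq : q ≠ 0) (hroot : ∀ k : ℕ, 0 < k → q ^ k ≠ 1) (K : ℕ) (M : ℤ)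
    (hM : M < K) (W : ℂ) (hW : W = q ^ (3 * (M - 2))) :
    (1 - q ^ 6 * W) * capT q K M (-2) (-3) +
      ((-1) + (-1*q^3) + (-1*q^3*W^1) + 1*q^6*W^1 + (-1*q^7*W^2) + (-1*q^8*W^2)) * capT q K (M - 1) (-2) (-3) +
      (q ^ 3 * ((1 - q ^ 3 * W ^ 2) * (1 + W))) * capT q K (M - 2) (-2) (-3) = 0 := by
  have w0 : W * q ^ 6 = q ^ (3 * M) := by
    rw [hW, ← zpow_natCast q 6, ← zpow_add₀ hq]; congr 1; push_cast; ring
  have w1 : W * q ^ 3 = q ^ (3 * (M - 1)) := by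
    rw [hW, ← zpow_natCast q 3, ← zpow_add₀ hq]; congr 1; push_cast; ring
  have r0 := capT_A q hq hroot K M (-5) (-9) (by omega) (M - 1) (-4) (-1) (-3) 3 0 (by ring) (by norm_num) (by norm_num) (by norm_num) (by norm_num)
  have r1 := capT_A q hq hroot K M (-4) (-3) (by omega) (M - 1) (-3) 0 3 2 0 (by ring) (by norm_num) (by norm_num) (by norm_num) (by norm_num)
  have r2 := capT_A q hq hroot K M (-3) (-3) (by omega) (M - 1) (-2) 1 3 1 0 (by ring) (by norm_num) (by norm_num) (by norm_num) (by norm_num)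
  have r3 := capT_A q hq hroot K M (-2) (-3) (by omega) (M - 1) (-1) 2 3 0 0 (by ring) (by norm_num) (by norm_num) (by norm_num) (by norm_num)
  have r4 := capT_A q hq hroot K (M - 1) (-4) (-6) (by omega) (M - 2) (-3) 0 0 2 0 (by ring) (by norm_num) (by norm_num) (by norm_num) (by norm_num)
  have r5 := capT_A q hq hroot K (M - 1) (-3) (-3) (by omega) (M - 2) (-2) 1 3 1 0 (by ring) (by norm_num) (by norm_num) (by norm_num) (by norm_num)
  have r6 := capT_A q hq hroot K (M - 1) (-1) 0 (by omega) (M - 2) 0 3 6 0 1 (by ring) (by norm_num) (by norm_num) (by norm_num) (by norm_num)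
  have r7 := capT_A q hq hroot K (M - 1) 1 3 (by omega) (M - 2) 2 5 9 0 3 (by ring) (by norm_num) (by norm_num) (by norm_num) (by norm_num)
  have r8 := capT_A q hq hroot K (M - 2) (-2) (-3) (by omega) (M - 3) (-1) 2 3 0 0 (by ring) (by norm_num) (by norm_num) (by norm_num) (by norm_num)
  have r9 := capT_A q hq hroot K (M - 2) (-1) 0 (by omega) (M - 3) 0 3 6 0 1 (by ring) (by norm_num) (by norm_num) (by norm_num) (by norm_num)
  have r10 := capT_A q hq hroot K (M - 2) 1 3 (by omega) (M - 3) 2 5 9 0 3 (by ring) (by norm_num) (by norm_num) (by norm_num) (by norm_num)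
  have r11 := capT_A q hq hroot K (M - 2) 2 6 (by omega) (M - 3) 3 6 12 0 4 (by ring) (by norm_num) (by norm_num) (by norm_num) (by norm_num)
  have r12 := capT_B q hq hroot K M (-4) (-9) (by omega) (M - 2) (-6) 2 3 3 0 (by ring) (by norm_num) (by norm_num) (by norm_num) (by norm_num)
  have r13 := capT_B q hq hroot K M (-4) (-6) (by omega) (M - 2) (-3) 2 6 0 0 (by ring) (by norm_num) (by norm_num) (by norm_num) (by norm_num)
  have r14 := capT_B q hq hroot K M (-1) (-3) (by omega) (M - 2) 0 5 9 0 3 (by ring) (by norm_num) (by norm_num) (by norm_num) (by norm_num)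
  have r15 := capT_B q hq hroot K (M - 1) (-4) (-9) (by omega) (M - 3) (-6) 2 3 3 0 (by ring) (by norm_num) (by norm_num) (by norm_num) (by norm_num)
  have r16 := capT_B q hq hroot K (M - 1) (-3) (-6) (by omega) (M - 3) (-3) 3 6 0 0 (by ring) (by norm_num) (by norm_num) (by norm_num) (by norm_num)
  have r17 := capT_B q hq hroot K (M - 1) (-1) (-3) (by omega) (M - 3) 0 5 9 0 3 (by ring) (by norm_num) (by norm_num) (by norm_num) (by norm_num)
  have r18 := capT_B q hq hroot K (M - 1) 0 0 (by omega) (M - 3) 3 6 12 0 6 (by ring) (by norm_num) (by norm_num) (by norm_num) (by norm_num)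
  have r19 := capT_C q hq hroot K M (-2) (-3) (M - 1) (-5) (-9) (W * q ^ 6) w0 (by ring) (by norm_num) (by norm_num)
  have r20 := capT_C q hq hroot K M (-1) 0 (M - 1) (-4) (-6) (W * q ^ 6) w0 (by ring) (by norm_num) (by norm_num)
  have r21 := capT_C q hq hroot K (M - 1) (-1) (-3) (M - 2) (-4) (-9) (W * q ^ 3) w1 (by ring) (by norm_num) (by norm_num)
  have r22 := capT_C q hq hroot K (M - 1) (-1) 0 (M - 2) (-4) (-6) (W * q ^ 3) w1 (by ring) (by norm_num) (by norm_num)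
  have r23 := capT_C q hq hroot K (M - 1) 2 3 (M - 2) (-1) (-3) (W * q ^ 3) w1 (by ring) (by norm_num) (by norm_num)
  have r24 := capT_C q hq hroot K (M - 2) 2 3 (M - 3) (-1) (-3) W hW (by ring) (by norm_num) (by norm_num)
  have r25 := capT_C q hq hroot K (M - 2) 3 6 (M - 3) 0 0 W hW (by ring) (by norm_num) (by norm_num)
  have r26 := capT_C q hq hroot K (M - 2) 5 9 (M - 3) 2 3 W hW (by ring) (by norm_num) (by norm_num)
  linear_combination (1*q^3*W^1 + 1*q^6*W^1 + 1*q^6*W^2 + 1*q^11*W^3) * r0 +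
    (1*q^4*W^1) * r1 +
    (1*q^5*W^1) * r2 +
    ((-1*q^3) + (-1*q^3*W^1) + (-1*q^8*W^2)) * r3 +
    ((-1*q^4*W^1) + 1*q^5*W^2) * r4 +
    ((-1*q^5*W^1) + 1*q^6*W^2) * r5 +
    ((-1*q^4*W^1)) * r6 +
    (1*q^5*W^1) * r7 +
    (1*q^3 + 1*q^3*W^1 + (-1*q^6*W^2) + (-1*q^6*W^3)) * r8 +
    (1*q^4*W^1 + (-1*q^6*W^2)) * r9 +
    ((-1*q^5*W^1) + 1*q^6*W^2) * r10 +
    (1*q^6*W^1) * r11 +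
    (1*q^3*W^1 + 1*q^6*W^1 + 1*q^6*W^2 + 1*q^11*W^3) * r12 +
    (1*q^6*W^1) * r13 +
    ((-1*q^3) + (-1*q^3*W^1) + (-1*q^8*W^2)) * r14 +
    ((-1*q^3*W^1) + 1*q^6*W^3) * r15 +
    ((-1*q^6*W^1) + 1*q^7*W^2) * r16 +
    (1*q^3 + 1*q^3*W^1 + (-1*q^6*W^2) + 1*q^8*W^2) * r17 +
    ((-1*q^4*W^1)) * r18 +
    (1 + 1*q^3 + 1*q^3*W^1 + 1*q^8*W^2) * r19 +
    ((-1*q^3) + (-1*q^3*W^1) + (-1*q^8*W^2)) * r20 +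
    ((-1*q^3) + 1*q^6*W^2) * r21 +
    (1*q^4*W^1 + (-1*q^6*W^2)) * r22 +
    ((-1*q^3) + (-1*q^3*W^1) + 1*q^5*W^1 + (-1*q^8*W^2)) * r23 +
    ((-1*q^3) + 1*q^6*W^2) * r24 +
    ((-1*q^5*W^1) + 1*q^6*W^1) * r25 +
    ((-1*q^6) + (-1*q^6*W^1) + 1*q^8*W^1 + (-1*q^11*W^2)) * r26

set_option maxHeartbeats 4000000 in
lemma capF_rec (q : ℂ) (hq : q ≠ 0) (hroot : ∀ k : ℕ, 0 < k → q ^ k ≠ 1) (K : ℕ) (M : ℤ)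
    (hM : M < K) (W : ℂ) (hW : W = q ^ (3 * (M - 2))) :
    (1 - q ^ 6 * W) * ((1 - q ^ 9 * W ^ 2) * (1 + q ^ 3 * W)) * (capU q K M M (-2) + capU q K M M 1) +
      ((-1) + (-1*q^3) + (-1*q^3*W^1) + 1*q^6*W^1 + (-1*q^7*W^2) + (-1*q^8*W^2)) * (capU q K (M - 1) (M - 1) (-2) + capU q K (M - 1) (M - 1) 1) +
      q ^ 3 * (capU q K (M - 2) (M - 2) (-2) + capU q K (M - 2) (M - 2) 1) = 0 := by
  have w0 : W * q ^ 6 = q ^ (3 * M) := by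
    rw [hW, ← zpow_natCast q 6, ← zpow_add₀ hq]; congr 1; push_cast; ring
  have w1 : W * q ^ 3 = q ^ (3 * (M - 1)) := by
    rw [hW, ← zpow_natCast q 3, ← zpow_add₀ hq]; congr 1; push_cast; ring
  have r0 := capU_1 q hq hroot K M M 1 (M - 1) (-2) (W * q ^ 6) w0 (by ring) (by norm_num)
  have r1 := capU_1 q hq hroot K (M - 1) M 4 (M - 2) 1 (W * q ^ 3) w1 (by ring) (by norm_num)
  have r2 := capU_1 q hq hroot K (M - 1) (M - 1) 1 (M - 2) (-2) (W * q ^ 3) w1 (by ring) (by norm_num)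
  have r3 := capU_1 q hq hroot K (M - 1) (M - 2) (-2) (M - 2) (-5) (W * q ^ 3) w1 (by ring) (by norm_num)
  have r4 := capU_2 q hq hroot K M M (-2) (M - 1) 1 (W * q ^ 6) w0 (by ring) (by norm_num)
  have r5 := capU_2 q hq hroot K (M - 1) M 1 (M - 1) 4 (W * q ^ 6) w0 (by ring) (by norm_num)
  have r6 := capU_2 q hq hroot K (M - 1) (M - 1) (-2) (M - 2) 1 (W * q ^ 3) w1 (by ring) (by norm_num)
  have r7 := capU_2 q hq hroot K (M - 2) (M - 1) 1 (M - 2) 4 (W * q ^ 3) w1 (by ring) (by norm_num)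
  have r8 := capU_3 q hq K M (M - 1) (-2) (M - 1) M 4 (by omega) (by omega) 0 1 (by ring) (by ring) (by norm_num) (by norm_num)
  have r9 := capU_3 q hq K (M - 1) (M - 1) (-2) (M - 2) M 4 (by omega) (by omega) 0 1 (by ring) (by ring) (by norm_num) (by norm_num)
  have r10 := capU_3 q hq K (M - 1) (M - 2) (-5) (M - 2) (M - 1) 1 (by omega) (by omega) 2 0 (by ring) (by ring) (by norm_num) (by norm_num)
  have r11 := capU_3 q hq K (M - 1) (M - 2) (-2) (M - 2) (M - 1) 4 (by omega) (by omega) 0 1 (by ring) (by ring) (by norm_num) (by norm_num)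
  linear_combination (1 + 1*q^3*W^1 + (-1*q^9*W^2) + (-1*q^12*W^3)) * r0 +
    (1*q^1 + 1*q^4*W^1 + 1*q^6*W^1 + 1*q^9*W^2) * r1 +
    ((-1*q^3) + 1*q^4*W^1) * r2 +
    ((-1*q^3)) * r3 +
    (1 + 1*q^3*W^1 + (-1*q^9*W^2) + (-1*q^12*W^3)) * r4 +
    (1 + 1*q^3*W^1 + 1*q^4*W^1 + 1*q^7*W^2) * r5 +
    ((-1*q^3) + 1*q^5*W^1) * r6 +
    ((-1*q^3)) * r7 +
    (1 + 1*q^3*W^1 + (-1*q^9*W^2) + (-1*q^12*W^3)) * r8 +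
    ((-1) + (-1*q^3*W^1) + (-1*q^5*W^1) + (-1*q^8*W^2)) * r9 +
    ((-1*q^4*W^1)) * r10 +
    (1*q^5*W^1) * r11

/-- the sum side -/
noncomputable def capF (q : ℂ) (K : ℕ) (M : ℤ) : ℂ := capU q K M M (-2) + capU q K M M 1

noncomputable def capH (q : ℂ) : ℕ → ℂ
  | 0 => 1 / 2
  | (k + 1) => capH q k * ((1 - q ^ (3 * (2 * k + 1))) * (1 + q ^ (3 * k)))

lemma capH_eq (q : ℂ) (M : ℕ) :
    (1 + q ^ (3 * M)) * qPoch (q ^ 3) (q ^ 3) M * capH q M = qPoch (q ^ 3) (q ^ 3) (2 * M) := by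
  induction M with
  | zero => simp [capH, qPoch]; norm_num
  | succ k ih =>
    have h1 : qPoch (q ^ 3) (q ^ 3) (2 * (k + 1)) =
        qPoch (q ^ 3) (q ^ 3) (2 * k) * (1 - q ^ (3 * (2 * k + 1))) * (1 - q ^ (3 * (2 * k + 2))) := by
      have : 2 * (k + 1) = 2 * k + 1 + 1 := by ring
      rw [this]
      unfold qPoch
      rw [Finset.prod_range_succ, Finset.prod_range_succ]
      ring
    have h2 : qPoch (q ^ 3) (q ^ 3) (k + 1) = qPoch (q ^ 3) (q ^ 3) k * (1 - q ^ (3 * (k + 1))) := by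
      unfold qPoch
      rw [Finset.prod_range_succ]
      ring
    rw [h1, h2, ← ih, capH]
    ring

lemma capT_negM (q : ℂ) (K : ℕ) (M a b : ℤ) (h : M < 0) : capT q K M a b = 0 := by
  unfold capT
  apply Finset.sum_eq_zero; intro m _
  apply Finset.sum_eq_zero; intro n _
  rw [capZ_neg _ _ (by omega), mul_zero]

lemma capU_negM (q : ℂ) (K : ℕ) (M e : ℤ) (h : M < 0) : capU q K M M e = 0 := by
  unfold capU
  apply Finset.sum_eq_zero; intro j _
  rcases le_or_gt 0 j with hj | hj
  · rw [capZ_neg _ (M - j) (by omega)]; ring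
  · rw [capZ_neg _ (M + j) (by omega)]; ring

lemma capInv0 (x : ℂ) : qPochInvZ x 0 = 1 := by simp [qPochInvZ, qPoch]

lemma capT_zero (q : ℂ) (K : ℕ) (hK : 0 < K) (a b : ℤ) : capT q K 0 a b = 1 := by
  unfold capT
  rw [Finset.sum_eq_single 0, Finset.sum_eq_single 0]
  · simp [capInv0, qPoch]
  · intro n _ hn; rw [capZ_neg _ _ (by omega), mul_zero]
  · intro h; simp at h; omega
  · intro m _ hm
    apply Finset.sum_eq_zero; intro n _
    rw [capZ_neg _ _ (by omega), mul_zero]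
  · intro h; simp at h; omega

lemma capU_zero (q : ℂ) (K : ℕ) (e : ℤ) : capU q K 0 0 e = 1 := by
  unfold capU
  rw [Finset.sum_eq_single 0]
  · simp [capInv0]
  · intro j _ hj
    rcases le_or_gt 0 j with h | h
    · rw [capZ_neg _ (0 - j) (by omega)]; ring
    · rw [capZ_neg _ (0 + j) (by omega)]; ring
  · intro h; simp at h

lemma capMain (q : ℂ) (hq : q ≠ 0) (hroot : ∀ k : ℕ, 0 < k → q ^ k ≠ 1) (K : ℕ) :
    ∀ M : ℕ, M < K → capT q K M (-2) (-3) = capH q M * capF q K M := by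
  intro M
  induction M using Nat.strong_induction_on with
  | _ M ih =>
    intro hM
    rcases M with _ | _ | k
    · simp only [Nat.cast_zero, capF]
      rw [capT_zero q K hM, capU_zero, capU_zero]
      norm_num [capH]
    · have h0 := ih 0 (by norm_num) (by omega)
      obtain ⟨W, hW⟩ : ∃ W : ℂ, W = q ^ (3 * ((1 : ℤ) - 2)) := ⟨_, rfl⟩
      have hW1 : q ^ 3 * W = 1 := by
        rw [hW, ← zpow_natCast q 3, ← zpow_add₀ hq]; norm_num
      have hT := capT_rec q hq hroot K 1 (by exact_mod_cast hM) W hW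
      have hF := capF_rec q hq hroot K 1 (by exact_mod_cast hM) W hW
      have A1 : 1 - q ^ 6 * W = 1 - q ^ 3 := by linear_combination -q ^ 3 * hW1
      have A2 : (1 - q ^ 9 * W ^ 2) * (1 + q ^ 3 * W) = 2 * (1 - q ^ 3) := by
        have : q ^ 9 * W ^ 2 = q ^ 3 := by linear_combination q ^ 3 * (q ^ 3 * W + 1) * hW1
        rw [this, hW1]; ring
      rw [A1, capT_negM q K (1 - 2) _ _ (by norm_num)] at hT
      rw [A1, A2, capU_negM q K (1 - 2) _ (by norm_num),
        capU_negM q K (1 - 2) _ (by norm_num)] at hF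
      have hne : 1 - q ^ 3 ≠ 0 := sub_ne_zero.mpr (Ne.symm (hroot 3 (by norm_num)))
      have c0 : (1 : ℤ) - 1 = ((0 : ℕ) : ℤ) := by norm_num
      have c1 : ((0 + 1 : ℕ) : ℤ) = 1 := by norm_num
      rw [c0] at hT hF
      rw [c1]
      unfold capF at h0 ⊢
      rw [h0] at hT
      apply mul_left_cancel₀ hne
      simp only [capH] at hT ⊢
      linear_combination hT - 1 / 2 * hF
    · have h0 := ih k (by omega) (by omega)
      have h1 := ih (k + 1) (by omega) (by omega)
      have c1 : ((k + 2 : ℕ) : ℤ) - 1 = ((k + 1 : ℕ) : ℤ) := by push_cast; ring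
      have c2 : ((k + 2 : ℕ) : ℤ) - 2 = ((k : ℕ) : ℤ) := by push_cast; ring
      have hT := capT_rec q hq hroot K ((k + 2 : ℕ) : ℤ) (by exact_mod_cast hM) (q ^ (3 * k))
        (by rw [c2]; exact_mod_cast (zpow_natCast q (3 * k)).symm)
      have hF := capF_rec q hq hroot K ((k + 2 : ℕ) : ℤ) (by exact_mod_cast hM) (q ^ (3 * k))
        (by rw [c2]; exact_mod_cast (zpow_natCast q (3 * k)).symm)
      rw [c1, c2] at hT hF
      have hne : 1 - q ^ 6 * q ^ (3 * k) ≠ 0 := by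
        rw [← pow_add]
        exact sub_ne_zero.mpr (Ne.symm (hroot _ (by omega)))
      unfold capF at h0 h1 ⊢
      rw [h0, h1] at hT
      apply mul_left_cancel₀ hne
      simp only [capH] at hT ⊢
      linear_combination hT - capH q k * ((1 - q ^ (3 * (2 * k + 1))) * (1 + q ^ (3 * k))) * hF

end CapparelliProof

theorem finite_capparelli_mixed (M : ℕ) (q : ℂ) (hq : q ≠ 0) (hroot : ∀ k : ℕ, 0 < k → q ^ k ≠ 1) :
    (1 + q ^ (3 * M)) *
      (∑' m : ℕ, ∑' n : ℕ, q ^ (2 * (m : ℤ) ^ 2 + 6 * (m : ℤ) * (n : ℤ) + 6 * (n : ℤ) ^ 2 - 2 * (m : ℤ) - 3 * (n : ℤ)) * qPoch (q ^ 3) (q ^ 3) M *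
        (qPoch q q m)⁻¹ * (qPoch (q ^ 3) (q ^ 3) n)⁻¹ * qPochInvZ (q ^ 3) ((M : ℤ) - 2 * n - m)) =
    ∑ j ∈ Finset.Icc (-(M : ℤ)) (M : ℤ),
      q ^ (3 * j ^ 2 - 2 * j) * (1 + q ^ (3 * j)) * qBinom (2 * (M : ℤ)) ((M : ℤ) + j) (q ^ 3) := by
  have hT : (∑' m : ℕ, ∑' n : ℕ, q ^ (2 * (m : ℤ) ^ 2 + 6 * (m : ℤ) * (n : ℤ) + 6 * (n : ℤ) ^ 2 - 2 * (m : ℤ) - 3 * (n : ℤ)) * qPoch (q ^ 3) (q ^ 3) M *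
        (qPoch q q m)⁻¹ * (qPoch (q ^ 3) (q ^ 3) n)⁻¹ * qPochInvZ (q ^ 3) ((M : ℤ) - 2 * n - m))
      = qPoch (q ^ 3) (q ^ 3) M * capT q (M + 1) M (-2) (-3) := by
    unfold capT
    rw [tsum_eq_sum (s := Finset.range (M + 1))]
    · rw [Finset.mul_sum]
      apply Finset.sum_congr rfl
      intro m _
      rw [tsum_eq_sum (s := Finset.range (M + 1))]
      · rw [Finset.mul_sum]
        apply Finset.sum_congr rfl
        intro n _
        have e : 2 * (m : ℤ) ^ 2 + 6 * (m : ℤ) * (n : ℤ) + 6 * (n : ℤ) ^ 2 - 2 * (m : ℤ) - 3 * (n : ℤ)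
          = 2 * (m : ℤ) ^ 2 + 6 * (m : ℤ) * (n : ℤ) + 6 * (n : ℤ) ^ 2 + (-2) * m + (-3) * n := by ring
        rw [e]; ring
      · intro n hn
        simp only [Finset.mem_range] at hn
        rw [capZ_neg _ _ (by omega), mul_zero]
    · intro m hm
      simp only [Finset.mem_range] at hm
      have : ∀ n : ℕ, q ^ (2 * (m : ℤ) ^ 2 + 6 * (m : ℤ) * (n : ℤ) + 6 * (n : ℤ) ^ 2 - 2 * (m : ℤ) - 3 * (n : ℤ)) * qPoch (q ^ 3) (q ^ 3) M *
        (qPoch q q m)⁻¹ * (qPoch (q ^ 3) (q ^ 3) n)⁻¹ * qPochInvZ (q ^ 3) ((M : ℤ) - 2 * n - m) = 0 := by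
        intro n
        rw [capZ_neg _ _ (by omega), mul_zero]
      simp only [this, tsum_zero]
  have hF : ∑ j ∈ Finset.Icc (-(M : ℤ)) (M : ℤ),
      q ^ (3 * j ^ 2 - 2 * j) * (1 + q ^ (3 * j)) * qBinom (2 * (M : ℤ)) ((M : ℤ) + j) (q ^ 3)
      = qPoch (q ^ 3) (q ^ 3) (2 * M) * capF q (M + 1) M := by
    unfold capF capU
    rw [← Finset.sum_add_distrib, Finset.mul_sum]
    apply Finset.sum_subset_zero_on_sdiff
    · intro x; simp only [Finset.mem_Icc]; push_cast; omega
    · intro j hj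
      simp only [Finset.mem_sdiff, Finset.mem_Icc] at hj
      rcases le_or_gt 0 j with h | h
      · rw [capZ_neg _ ((M : ℤ) - j) (by omega)]; ring
      · rw [capZ_neg _ ((M : ℤ) + j) (by omega)]; ring
    · intro j hj
      simp only [Finset.mem_Icc] at hj
      unfold qBinom qPochInvZ
      rw [if_pos (by omega), if_pos (by omega), if_pos (by omega)]
      have e1 : (2 * (M : ℤ)).toNat = 2 * M := by omega
      have e2 : 2 * (M : ℤ) - (M + j) = M - j := by ring
      have e3 : q ^ (3 * j ^ 2 + (-2) * j) = q ^ (3 * j ^ 2 - 2 * j) := by congr 1; ring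
      have e4 : q ^ (3 * j ^ 2 + 1 * j) = q ^ (3 * j ^ 2 - 2 * j) * q ^ (3 * j) := by
        rw [← zpow_add₀ hq]; congr 1; ring
      rw [e1, e2, e3, e4]; ring
  rw [hT, hF, capMain q hq hroot (M + 1) M (by omega), ← capH_eq q M]
  ring
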